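/- arXiv:2104.11201 — 6 statements merged into one kernel-verified Lean document; each statement's English description precedes it below -/
import Mathlib

section
/- Let λ > 0 and let ω : ℝ → ℝ be continuous with ω(0) = 0 and ω(τ)/τ → 0 as τ → −∞. Define z(t) := −λ ∫_{−∞}^{0} e^{λτ} ω(t + τ) dτ + ω(t). Then z is continuous and satisfies the integrated Ornstein–Uhlenbeck equation z(t) = z(0) − λ ∫_{0}^{t} z(s) ds + ω(t) for all t ∈ ℝ. -/
open Filter Set MeasureTheory

open Asymptotics in
/-- A continuous path of at most linear growth at `-∞` is integrable against `e^{λu}` there. -/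
theorem integrableOn_Iic_exp_mul_of_isBigO {lam : ℝ} (hlam : 0 < lam) {ω : ℝ → ℝ}
    (hω : Continuous ω) (hO : ω =O[atBot] fun τ => τ) (t : ℝ) :
    IntegrableOn (fun u => Real.exp (lam * u) * ω u) (Iic t) := by
  have hO' : (fun v => ω (-v)) =O[atTop] fun v => Real.exp (lam / 2 * v) := by
    have h1 : (fun v => ω (-v)) =O[atTop] fun v : ℝ => -v :=
      hO.comp_tendsto tendsto_neg_atTop_atBot
    have h2 := (isLittleO_pow_exp_pos_mul_atTop 1 (half_pos hlam)).isBigO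
    simp only [pow_one] at h2
    exact h1.neg_right.trans (by simpa using h2)
  have hg : IntegrableOn (fun v => Real.exp (lam * -v) * ω (-v)) (Ioi (-t)) := by
    refine integrable_of_isBigO_exp_neg (half_pos hlam) (by fun_prop) ?_
    refine ((isBigO_refl (fun v => Real.exp (lam * -v)) atTop).mul hO').congr_right fun v => ?_
    rw [← Real.exp_add]
    ring_nf
  rw [integrableOn_Iic_iff_integrableOn_Iio]
  simpa using hg.comp_neg_Iio

theorem integral_Iic_zero_comp_add_left (f : ℝ → ℝ) (t : ℝ) :
    ∫ τ in Iic (0 : ℝ), f (t + τ) = ∫ u in Iic t, f u := by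
  have h := (measurePreserving_add_left volume t).setIntegral_preimage_emb
    (measurableEmbedding_addLeft t) f (Iic t)
  simpa using h

/-- The discounted past `t ↦ ∫_{-∞}^0 e^{λτ} ω(t+τ) dτ` has derivative
`-λ ∫_{-∞}^0 e^{λτ} ω(t+τ) dτ + ω(t)`. -/
theorem hasDerivAt_integral_Iic_exp_mul {lam : ℝ} {ω : ℝ → ℝ} (hω : Continuous ω)
    (hint : ∀ t, IntegrableOn (fun u => Real.exp (lam * u) * ω u) (Iic t)) (t : ℝ) :
    HasDerivAt (fun s => ∫ τ in Iic (0 : ℝ), Real.exp (lam * τ) * ω (s + τ))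
      (-lam * (∫ τ in Iic (0 : ℝ), Real.exp (lam * τ) * ω (t + τ)) + ω t) t := by
  have key : ∀ s, ∫ τ in Iic (0 : ℝ), Real.exp (lam * τ) * ω (s + τ) =
      Real.exp (-lam * s) * ((∫ u in Iic (0 : ℝ), Real.exp (lam * u) * ω u) +
        ∫ u in (0 : ℝ)..s, Real.exp (lam * u) * ω u) := by
    intro s
    rw [← intervalIntegral.integral_Iic_sub_Iic (hint 0) (hint s), add_sub_cancel,
      ← integral_Iic_zero_comp_add_left (fun u => Real.exp (lam * u) * ω u) s,
      ← integral_const_mul]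
    congr 1 with τ
    rw [← mul_assoc, ← Real.exp_add]
    ring_nf
  have hF : Continuous fun u => Real.exp (lam * u) * ω u := by fun_prop
  have hexp : HasDerivAt (fun s => Real.exp (-lam * s)) (Real.exp (-lam * t) * -lam) t := by
    simpa using ((hasDerivAt_id t).const_mul (-lam)).exp
  have h := hexp.mul ((hF.integral_hasStrictDerivAt 0 t).hasDerivAt.const_add
    (∫ u in Iic (0 : ℝ), Real.exp (lam * u) * ω u))
  rw [key t, funext key]
  refine h.congr_deriv ?_
  rw [← mul_assoc (Real.exp (-lam * t)) (Real.exp (lam * t)),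
    ← Real.exp_add, neg_mul, neg_add_cancel, Real.exp_zero]
  ring

/-- For `λ > 0` and a continuous path `ω` with `ω 0 = 0` and `ω(τ)/τ → 0` as `τ → -∞`,
the process `z(t) = -λ ∫_{-∞}^0 e^{λτ} ω(t+τ) dτ + ω(t)` is continuous and solves the
integrated Ornstein–Uhlenbeck equation `z(t) = z(0) - λ ∫_0^t z(s) ds + ω(t)`. -/
theorem ou_stationary_solution (lam : ℝ) (hlam : 0 < lam)
    (ω : ℝ → ℝ) (hω : Continuous ω) (hω0 : ω 0 = 0)
    (hsub : Tendsto (fun τ => ω τ / τ) atBot (nhds 0))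
    (z : ℝ → ℝ)
    (hz : ∀ t, z t = -lam * (∫ τ in Iic (0 : ℝ), Real.exp (lam * τ) * ω (t + τ)) + ω t) :
    Continuous z ∧
    ∀ t : ℝ, z t = z 0 - lam * (∫ s in (0 : ℝ)..t, z s) + ω t := by
  have hO : ω =O[atBot] fun τ => τ := by
    refine (Asymptotics.isLittleO_of_tendsto' ?_ hsub).isBigO
    filter_upwards [eventually_lt_atBot 0] with τ hτ h0
    exact absurd h0 hτ.ne
  have hderiv := hasDerivAt_integral_Iic_exp_mul hω
    (integrableOn_Iic_exp_mul_of_isBigO hlam hω hO)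
  have hcont : Continuous z := by
    rw [funext hz]
    exact (continuous_const.mul
      (continuous_iff_continuousAt.2 fun t => (hderiv t).continuousAt)).add hω
  refine ⟨hcont, fun t => ?_⟩
  simp only [← hz] at hderiv
  rw [intervalIntegral.integral_eq_sub_of_hasDerivAt (fun s _ => hderiv s)
    (hcont.intervalIntegrable 0 t), hz t, hz 0, hω0]
  ring
end

section
/- Let λ > 0 and let ω : ℝ → ℝ be continuous with ω(t)/t → 0 as t → ±∞. Define z(t) := −λ ∫_{−∞}^{0} e^{λτ} ω(t + τ) dτ + ω(t). Then |z(t)|/|t| → 0 as t → +∞ and as t → −∞. -/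
open Filter Set MeasureTheory

/-- A continuous function that is `o(t)` at infinity is bounded by `ε|t| + C` for every `ε > 0`. -/
lemma exists_forall_abs_le_mul_abs_add {f : ℝ → ℝ} (hf : Continuous f)
    (hTop : Tendsto (fun t => f t / t) atTop (nhds 0))
    (hBot : Tendsto (fun t => f t / t) atBot (nhds 0)) {ε : ℝ} (hε : 0 < ε) :
    ∃ C, ∀ t, |f t| ≤ ε * |t| + C := by
  have key : ∀ t, t ≠ 0 → |f t / t| < ε → |f t| ≤ ε * |t| := fun t ht h => by
    rw [abs_div, div_lt_iff₀ (abs_pos.2 ht)] at h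
    exact h.le
  have h1 := (hTop.abs.eventually_lt_const (by simpa using hε)).and (eventually_gt_atTop 0)
  have h2 := (hBot.abs.eventually_lt_const (by simpa using hε)).and (eventually_lt_atBot 0)
  obtain ⟨b, hb⟩ := eventually_atTop.1 h1
  obtain ⟨a, ha⟩ := eventually_atBot.1 h2
  obtain ⟨C, hC⟩ := isCompact_Icc.exists_bound_of_continuousOn (s := Icc a b) hf.continuousOn
  refine ⟨max C 0, fun t => ?_⟩
  have hεt : 0 ≤ ε * |t| := by positivity
  have hC0 : 0 ≤ max C 0 := le_max_right _ _
  rcases le_total b t with h | h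
  · linarith [key t (hb t h).2.ne' (hb t h).1]
  rcases le_total t a with h' | h'
  · linarith [key t (ha t h').2.ne (ha t h').1]
  · have := hC t ⟨h', h⟩
    rw [Real.norm_eq_abs] at this
    linarith [le_max_left C 0]

/-- A function bounded by `ε|t| + C` for every `ε > 0` is `o(t)` along any filter on which
`|t| → ∞`. -/
lemma tendsto_abs_div_abs_of_forall_le_mul_abs_add {f : ℝ → ℝ} {l : Filter ℝ}
    (hl : Tendsto (fun t : ℝ => |t|) l atTop)
    (hf : ∀ ε > 0, ∃ C, ∀ t, |f t| ≤ ε * |t| + C) :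
    Tendsto (fun t => |f t| / |t|) l (nhds 0) := by
  refine tendsto_order.2 ⟨fun a ha => .of_forall fun t => ha.trans_le (by positivity),
    fun ε hε => ?_⟩
  obtain ⟨C, hC⟩ := hf (ε / 2) (half_pos hε)
  filter_upwards [hl.eventually_gt_atTop 0, hl.eventually_gt_atTop (C / (ε / 2))] with t h0 h1
  rw [div_lt_iff₀ (half_pos hε)] at h1
  rw [div_lt_iff₀ h0]
  linarith [hC t]

/-- Exponentially weighted half-line averages preserve a bound of the form `ε|t| + C`. -/
lemma abs_integral_exp_mul_comp_add_le {lam ε C : ℝ} (hlam : 0 < lam) (hε : 0 ≤ ε)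
    {f : ℝ → ℝ} (hf : ∀ t, |f t| ≤ ε * |t| + C) (t : ℝ) :
    |∫ τ in Iic (0 : ℝ), Real.exp (lam * τ) * f (t + τ)| ≤
      (ε * |t| + C) / lam + 4 * ε / lam ^ 2 := by
  have hhalf : 0 < lam / 2 := half_pos hlam
  have i1 := (integrableOn_exp_mul_Iic hlam 0).const_mul (ε * |t| + C)
  have i2 := (integrableOn_exp_mul_Iic hhalf 0).const_mul (ε * (2 / lam))
  rw [← Real.norm_eq_abs]
  refine (norm_integral_le_of_norm_le (i1.add i2) ?_).trans_eq ?_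
  · filter_upwards [ae_restrict_mem measurableSet_Iic] with τ (hτ0 : τ ≤ 0)
    have habs : |τ| * Real.exp (lam * τ) ≤ 2 / lam * Real.exp (lam / 2 * τ) := by
      have hsplit : Real.exp (lam * τ) = Real.exp (lam / 2 * τ) * Real.exp (lam / 2 * τ) := by
        rw [← Real.exp_add]; ring_nf
      have hexp : |τ| * Real.exp (lam / 2 * τ) ≤ 2 / lam := by
        have h := Real.add_one_le_exp (-(lam / 2 * τ))
        rw [Real.exp_neg] at h
        rw [abs_of_nonpos hτ0, ← le_div_iff₀ (Real.exp_pos _), div_eq_mul_inv,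
          ← div_le_iff₀' (by positivity)]
        refine le_trans (le_of_eq ?_) (le_trans (by linarith) h : -(lam / 2 * τ) ≤ _)
        field_simp
      rw [hsplit, ← mul_assoc]
      gcongr
    have hshift : |f (t + τ)| ≤ (ε * |t| + C) + ε * |τ| := by
      have := mul_le_mul_of_nonneg_left (abs_add_le t τ) hε
      linarith [hf (t + τ)]
    rw [norm_mul, Real.norm_eq_abs, Real.norm_eq_abs, Real.abs_exp]
    have h1 := mul_le_mul_of_nonneg_left hshift (Real.exp_pos (lam * τ)).le
    have h2 := mul_le_mul_of_nonneg_left habs hε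
    simp only [Pi.add_apply]
    linarith
  · simp only [Pi.add_apply]
    rw [integral_add i1 i2, integral_const_mul, integral_const_mul, integral_exp_mul_Iic hlam,
      integral_exp_mul_Iic hhalf]
    simp only [mul_zero, Real.exp_zero]
    field_simp
    ring

/-- For `λ > 0` and a continuous path `ω` with `ω(t)/t → 0` as `t → ±∞`, the process
`z(t) = -λ ∫_{-∞}^0 e^{λτ} ω(t+τ) dτ + ω(t)` satisfies `|z(t)|/|t| → 0` as `t → ±∞`. -/
theorem ou_sublinear_growth (lam : ℝ) (hlam : 0 < lam)
    (ω : ℝ → ℝ) (hω : Continuous ω)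
    (hsubTop : Tendsto (fun t => ω t / t) atTop (nhds 0))
    (hsubBot : Tendsto (fun t => ω t / t) atBot (nhds 0))
    (z : ℝ → ℝ)
    (hz : ∀ t, z t = -lam * (∫ τ in Iic (0 : ℝ), Real.exp (lam * τ) * ω (t + τ)) + ω t) :
    Tendsto (fun t => |z t| / |t|) atTop (nhds 0) ∧
    Tendsto (fun t => |z t| / |t|) atBot (nhds 0) := by
  have hbound : ∀ ε > 0, ∃ C, ∀ t, |z t| ≤ ε * |t| + C := fun ε hε => by
    obtain ⟨C, hC⟩ := exists_forall_abs_le_mul_abs_add hω hsubTop hsubBot (half_pos hε)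
    refine ⟨2 * C + 2 * ε / lam, fun t => ?_⟩
    have hint := mul_le_mul_of_nonneg_left
      (abs_integral_exp_mul_comp_add_le hlam (half_pos hε).le hC t) hlam.le
    have hcalc : lam * ((ε / 2 * |t| + C) / lam + 4 * (ε / 2) / lam ^ 2) =
        ε / 2 * |t| + C + 2 * ε / lam := by
      field_simp
      ring
    have htri := abs_add_le
      (-lam * ∫ τ in Iic (0 : ℝ), Real.exp (lam * τ) * ω (t + τ)) (ω t)
    rw [abs_mul, abs_neg, abs_of_pos hlam] at htri
    rw [hz t]
    linarith [hC t]
  exact ⟨tendsto_abs_div_abs_of_forall_le_mul_abs_add tendsto_abs_atTop_atTop hbound,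
    tendsto_abs_div_abs_of_forall_le_mul_abs_add tendsto_abs_atBot_atTop hbound⟩
end

section
/- For every μ ∈ ℝ and every a ≠ 0, one has ∫_{0}^{∞} (|a| / √(2π t³)) · exp( −(a − μ t)² / (2t) ) dt = exp( μ a − |μ a| ). -/
open Real MeasureTheory

open Filter Topology

lemma tendsto_intervalIntegral_exp_neg_sq_div_two_atTop :
    Tendsto (fun x : ℝ ↦ ∫ s in (0 : ℝ)..x, exp (-s ^ 2 / 2)) atTop (𝓝 (√(2 * π) / 2)) := by
  have hg : (fun s : ℝ ↦ exp (-s ^ 2 / 2)) = fun s ↦ exp (-(1 / 2) * s ^ 2) := by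
    ext s; ring_nf
  have hL : √(2 * π) / 2 = ∫ s in Set.Ioi (0 : ℝ), exp (-s ^ 2 / 2) := by
    rw [hg, integral_gaussian_Ioi]
    congr 2
    ring
  rw [hL]
  refine intervalIntegral_tendsto_integral_Ioi 0 ?_ tendsto_id
  rw [hg]
  exact (integrable_exp_neg_mul_sq (by norm_num)).integrableOn

lemma intervalIntegral_exp_neg_sq_div_two_neg (x : ℝ) :
    ∫ s in (0 : ℝ)..(-x), exp (-s ^ 2 / 2) = -∫ s in (0 : ℝ)..x, exp (-s ^ 2 / 2) := by
  have h := intervalIntegral.integral_comp_neg (a := 0) (b := x) fun s : ℝ ↦ exp (-s ^ 2 / 2)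
  simp only [neg_sq, neg_zero] at h
  rw [h, ← intervalIntegral.integral_symm]

lemma tendsto_intervalIntegral_exp_neg_sq_div_two_atBot :
    Tendsto (fun x : ℝ ↦ ∫ s in (0 : ℝ)..x, exp (-s ^ 2 / 2)) atBot (𝓝 (-(√(2 * π) / 2))) := by
  have h := (tendsto_intervalIntegral_exp_neg_sq_div_two_atTop.comp tendsto_neg_atBot_atTop).neg
  refine h.congr fun x ↦ ?_
  simp [intervalIntegral_exp_neg_sq_div_two_neg]

lemma hasDerivAt_intervalIntegral_exp_neg_sq_div_two (x : ℝ) :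
    HasDerivAt (fun x : ℝ ↦ ∫ s in (0 : ℝ)..x, exp (-s ^ 2 / 2)) (exp (-x ^ 2 / 2)) x := by
  have hc : Continuous fun s : ℝ ↦ exp (-s ^ 2 / 2) := by fun_prop
  exact intervalIntegral.integral_hasDerivAt_right (hc.intervalIntegrable _ _)
    (hc.stronglyMeasurableAtFilter _ _) hc.continuousAt

lemma hasDerivAt_mul_sqrt_sub_div_sqrt (m b : ℝ) {t : ℝ} (ht : 0 < t) :
    HasDerivAt (fun t ↦ m * √t - b / √t) (m / (2 * √t) + b / (2 * (t * √t))) t := by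
  have hs : √t ≠ 0 := (sqrt_pos.2 ht).ne'
  have h := hasDerivAt_sqrt ht.ne'
  refine ((h.const_mul m).sub ((hasDerivAt_const t b).div h hs)).congr_deriv ?_
  rw [sq_sqrt ht.le]
  field_simp
  ring

lemma tendsto_div_sqrt_nhdsGT_zero {b : ℝ} (hb : 0 < b) :
    Tendsto (fun t ↦ b / √t) (𝓝[>] 0) atTop := by
  have h : Tendsto (fun t : ℝ ↦ √t) (𝓝[>] 0) (𝓝[>] 0) := by
    refine tendsto_nhdsWithin_iff.2 ⟨?_, ?_⟩
    · simpa using (continuous_sqrt.tendsto 0).mono_left nhdsWithin_le_nhds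
    · filter_upwards [self_mem_nhdsWithin] with t ht using sqrt_pos.2 ht
  simpa only [div_eq_mul_inv, Function.comp_apply] using (tendsto_inv_nhdsGT_zero.comp h).const_mul_atTop hb

lemma tendsto_mul_sqrt_sub_div_sqrt_nhdsGT_zero (m : ℝ) {b : ℝ} (hb : 0 < b) :
    Tendsto (fun t ↦ m * √t - b / √t) (𝓝[>] 0) atBot := by
  have h : Tendsto (fun t : ℝ ↦ m * √t) (𝓝[>] 0) (𝓝 (m * √0)) :=
    ((continuous_const.mul continuous_sqrt).tendsto 0).mono_left nhdsWithin_le_nhds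
  simpa only [sub_eq_add_neg, Function.comp_apply] using
    h.add_atBot (tendsto_neg_atTop_atBot.comp (tendsto_div_sqrt_nhdsGT_zero hb))

lemma tendsto_div_sqrt_atTop (b : ℝ) : Tendsto (fun t ↦ b / √t) atTop (𝓝 0) :=
  tendsto_sqrt_atTop.const_div_atTop b

lemma tendsto_mul_sqrt_sub_div_sqrt_atTop {m : ℝ} (hm : 0 < m) (b : ℝ) :
    Tendsto (fun t ↦ m * √t - b / √t) atTop atTop := by
  simpa only [sub_eq_add_neg] using
    (tendsto_sqrt_atTop.const_mul_atTop hm).atTop_add (tendsto_div_sqrt_atTop b).neg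

lemma tendsto_neg_mul_sqrt_sub_div_sqrt_atTop {m : ℝ} (hm : 0 < m) (b : ℝ) :
    Tendsto (fun t ↦ -m * √t - b / √t) atTop atBot := by
  refine (tendsto_neg_atTop_atBot.comp (tendsto_mul_sqrt_sub_div_sqrt_atTop hm (-b))).congr
    fun t ↦ ?_
  simp only [Function.comp_apply]
  ring

/-- An antiderivative of `√(2 π)` times the first passage density. -/
noncomputable def firstPassagePrimitive (m b t : ℝ) : ℝ :=
  (∫ s in (0 : ℝ)..(m * √t - b / √t), exp (-s ^ 2 / 2)) +
    exp (2 * m * b) * ∫ s in (0 : ℝ)..(-m * √t - b / √t), exp (-s ^ 2 / 2)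

lemma neg_sq_mul_sqrt_sub_div_sqrt (m b : ℝ) {t : ℝ} (ht : 0 < t) :
    -(m * √t - b / √t) ^ 2 / 2 = -(b - m * t) ^ 2 / (2 * t) := by
  have hs : √t ≠ 0 := (sqrt_pos.2 ht).ne'
  have h : m * √t - b / √t = (m * t - b) / √t := by
    field_simp
    rw [sq_sqrt ht.le]
  rw [h, div_pow, sq_sqrt ht.le]
  field_simp
  ring

lemma hasDerivAt_firstPassagePrimitive (m b : ℝ) {t : ℝ} (ht : 0 < t) :
    HasDerivAt (firstPassagePrimitive m b)
      (b / (t * √t) * exp (-(b - m * t) ^ 2 / (2 * t))) t := by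
  have hs : √t ≠ 0 := (sqrt_pos.2 ht).ne'
  have h (m : ℝ) := (hasDerivAt_intervalIntegral_exp_neg_sq_div_two _).comp t
    (hasDerivAt_mul_sqrt_sub_div_sqrt m b ht)
  refine ((h m).add ((h (-m)).const_mul (exp (2 * m * b)))).congr_deriv ?_
  rw [neg_sq_mul_sqrt_sub_div_sqrt _ _ ht, neg_sq_mul_sqrt_sub_div_sqrt _ _ ht]
  have he : exp (2 * m * b) * exp (-(b - -m * t) ^ 2 / (2 * t)) =
      exp (-(b - m * t) ^ 2 / (2 * t)) := by
    rw [← exp_add]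
    congr 1
    field_simp
    ring
  rw [← mul_assoc (exp (2 * m * b)), he]
  field_simp
  ring

lemma tendsto_firstPassagePrimitive_nhdsGT_zero (m : ℝ) {b : ℝ} (hb : 0 < b) :
    Tendsto (firstPassagePrimitive m b) (𝓝[>] 0)
      (𝓝 (-(√(2 * π) / 2) + exp (2 * m * b) * -(√(2 * π) / 2))) := by
  have h (m : ℝ) := tendsto_intervalIntegral_exp_neg_sq_div_two_atBot.comp
    (tendsto_mul_sqrt_sub_div_sqrt_nhdsGT_zero m hb)
  exact (h m).add ((h (-m)).const_mul _)

lemma tendsto_firstPassagePrimitive_atTop {m : ℝ} (hm : 0 ≤ m) (b : ℝ) :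
    Tendsto (firstPassagePrimitive m b) atTop
      (𝓝 (√(2 * π) / 2 + exp (2 * m * b) * -(√(2 * π) / 2))) := by
  rcases hm.eq_or_lt with rfl | hm
  · have hu : Tendsto (fun t : ℝ ↦ 0 * √t - b / √t) atTop (𝓝 0) := by
      simpa using (tendsto_div_sqrt_atTop b).neg
    have h := (hasDerivAt_intervalIntegral_exp_neg_sq_div_two 0).continuousAt.tendsto.comp hu
    have h2 := h.add h
    simp only [intervalIntegral.integral_same, add_zero] at h2
    convert h2 using 2 <;> simp [firstPassagePrimitive]
  · exact (tendsto_intervalIntegral_exp_neg_sq_div_two_atTop.comp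
      (tendsto_mul_sqrt_sub_div_sqrt_atTop hm b)).add
      ((tendsto_intervalIntegral_exp_neg_sq_div_two_atBot.comp
        (tendsto_neg_mul_sqrt_sub_div_sqrt_atTop hm b)).const_mul _)

lemma integral_first_passage_of_nonneg {m b : ℝ} (hm : 0 ≤ m) (hb : 0 < b) :
    ∫ t in Set.Ioi (0 : ℝ), b / (t * √t) * exp (-(b - m * t) ^ 2 / (2 * t)) = √(2 * π) := by
  set l := -(√(2 * π) / 2) + exp (2 * m * b) * -(√(2 * π) / 2)
  have hne {t : ℝ} (ht : 0 < t) :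
      Function.update (firstPassagePrimitive m b) 0 l =ᶠ[𝓝 t] firstPassagePrimitive m b := by
    filter_upwards [isOpen_ne.mem_nhds ht.ne'] with s hs using Function.update_of_ne hs _ _
  have h := integral_Ioi_of_hasDerivAt_of_nonneg (a := 0)
    (g := Function.update (firstPassagePrimitive m b) 0 l)
    (g' := fun t ↦ b / (t * √t) * exp (-(b - m * t) ^ 2 / (2 * t)))
    (l := √(2 * π) / 2 + exp (2 * m * b) * -(√(2 * π) / 2)) ?_ ?_ ?_ ?_
  · rw [h, Function.update_self]
    ring
  · rw [continuousWithinAt_update_same, Set.Ici_sdiff_left]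
    exact tendsto_firstPassagePrimitive_nhdsGT_zero m hb
  · exact fun t ht ↦ (hasDerivAt_firstPassagePrimitive m b ht).congr_of_eventuallyEq (hne ht)
  · intro t ht
    have : 0 < t := ht
    positivity
  · refine (tendsto_firstPassagePrimitive_atTop hm b).congr' ?_
    filter_upwards [eventually_ne_atTop 0] with t ht using (Function.update_of_ne ht _ _).symm

/-- The density of the first passage time of a Brownian motion with drift `μ` to the
level `a ≠ 0` integrates to `exp(μ a - |μ a|)`, the total probability of ever reaching
the level. -/
theorem first_passage_density_integral (μ : ℝ) (a : ℝ) (ha : a ≠ 0) :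
    ∫ t in Set.Ioi (0 : ℝ),
        (|a| / Real.sqrt (2 * Real.pi * t ^ 3)) * Real.exp (-(a - μ * t) ^ 2 / (2 * t)) =
      Real.exp (μ * a - |μ * a|) := by
  have hpt : ∀ t ∈ Set.Ioi (0 : ℝ),
      (|a| / √(2 * π * t ^ 3)) * exp (-(a - μ * t) ^ 2 / (2 * t)) =
        exp (μ * a - |μ * a|) / √(2 * π) *
          (|a| / (t * √t) * exp (-(|a| - |μ| * t) ^ 2 / (2 * t))) := by
    intro t ht
    have ht : 0 < t := ht
    have hsqrt : √(2 * π * t ^ 3) = √(2 * π) * (t * √t) := by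
      rw [sqrt_mul (by positivity), pow_succ t, sqrt_mul (sq_nonneg t), sqrt_sq ht.le]
    have hexp : -(a - μ * t) ^ 2 / (2 * t) =
        (μ * a - |μ * a|) + -(|a| - |μ| * t) ^ 2 / (2 * t) := by
      rw [abs_mul]
      field_simp
      linear_combination sq_abs a + t ^ 2 * sq_abs μ
    rw [hsqrt, hexp, exp_add]
    field_simp
  have hpi : √(2 * π) ≠ 0 := by positivity
  rw [setIntegral_congr_fun measurableSet_Ioi hpt, integral_const_mul,
    integral_first_passage_of_nonneg (abs_nonneg μ) (abs_pos.2 ha), div_mul_cancel₀ _ hpi]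
end

section
/- Let w : [0, ∞) → ℝ be continuous with w(0) = 0. Let y : [0, ∞) → ℝ be continuous with y(0) = 0, y(t) > 0 for all t > 0, and y(t) = ∫_{0}^{t} (1/y(s)) ds + w(t) for all t ≥ 0, the integral being finite. Let z0 > 0 and let z : [0, ∞) → ℝ be continuous with z(0) = z0 and such that for every t ≥ 0 with z(s) > 0 for all s ∈ [0, t] one has z(t) = z0 + (2/3) t + ∫_{0}^{t} (1/z(s)) ds + w(t). Then z(t) > 0 for all t ≥ 0 and z(t) ≥ y(t) for all t ≥ 0. -/
open Set MeasureTheory intervalIntegral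

/-- A function that is continuous on `[0, a]`, positive at `0` and nonpositive at `a` has a first
zero. -/
theorem exists_first_zero {f : ℝ → ℝ} {a : ℝ} (ha : 0 ≤ a) (hf : ContinuousOn f (Icc 0 a))
    (h0 : 0 < f 0) (hfa : f a ≤ 0) :
    ∃ T, 0 < T ∧ f T = 0 ∧ ∀ s, 0 ≤ s → s < T → 0 < f s := by
  have hcomp : IsCompact (Icc 0 a ∩ f ⁻¹' Iic 0) :=
    isCompact_Icc.of_isClosed_subset
      (hf.preimage_isClosed_of_isClosed isClosed_Icc isClosed_Iic) inter_subset_left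
  obtain ⟨T, ⟨hT, hfT⟩, hleast⟩ := hcomp.exists_isLeast ⟨a, ⟨ha, le_rfl⟩, hfa⟩
  have hbefore : ∀ s, 0 ≤ s → s < T → 0 < f s := by
    intro s hs hsT
    by_contra! h
    exact absurd (hleast ⟨⟨hs, hsT.le.trans hT.2⟩, h⟩) (not_le.2 hsT)
  obtain ⟨c, hc, hfc⟩ := intermediate_value_Icc' hT.1
    (hf.mono (Icc_subset_Icc_right hT.2)) ⟨hfT, h0.le⟩
  have hcT : T = c := le_antisymm (hleast ⟨⟨hc.1, hc.2.trans hT.2⟩, hfc.le⟩) hc.2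
  subst hcT
  refine ⟨T, hT.1.lt_of_ne ?_, hfc, hbefore⟩
  rintro rfl
  exact h0.ne' hfc

/-- Pathwise comparison (heart of Theorem 3.3): the pathwise solution `z` of
`dz = (2/3)dt + (1/z)dt + dw` with `z(0) = z0 > 0` dominates the path `y` of the
three-dimensional Bessel process (`dy = (1/y)dt + dw`, `y(0) = 0`, `y > 0` for `t > 0`),
hence `z` stays positive for all times. -/
theorem ito_comparison_positivity
    (w : ℝ → ℝ) (hw : ContinuousOn w (Ici 0)) (hw0 : w 0 = 0)
    (y : ℝ → ℝ) (hy : ContinuousOn y (Ici 0)) (hy0 : y 0 = 0)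
    (hypos : ∀ t : ℝ, 0 < t → 0 < y t)
    (hyint : ∀ t : ℝ, 0 ≤ t → IntervalIntegrable (fun s => 1 / y s) volume 0 t)
    (hyeq : ∀ t : ℝ, 0 ≤ t → y t = (∫ s in (0 : ℝ)..t, 1 / y s) + w t)
    (z0 : ℝ) (hz0 : 0 < z0)
    (z : ℝ → ℝ) (hz : ContinuousOn z (Ici 0)) (hzinit : z 0 = z0)
    (hzeq : ∀ t : ℝ, 0 ≤ t → (∀ s ∈ Icc (0 : ℝ) t, 0 < z s) →
      z t = z0 + (2 / 3) * t + (∫ s in (0 : ℝ)..t, 1 / z s) + w t) :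
    ∀ t : ℝ, 0 ≤ t → 0 < z t ∧ y t ≤ z t := by
  suffices hlt : ∀ t : ℝ, 0 ≤ t → y t < z t by
    intro t ht
    refine ⟨?_, (hlt t ht).le⟩
    rcases ht.eq_or_lt with rfl | h
    · rwa [hzinit]
    · exact (hypos t h).trans (hlt t ht)
  by_contra! ⟨a, ha, hza⟩
  obtain ⟨T, hT, hDT, hbefore⟩ := exists_first_zero (f := fun t => z t - y t) ha
    ((hz.sub hy).mono Icc_subset_Ici_self) (by simpa [hzinit, hy0]) (sub_nonpos.2 hza)
  simp only [sub_pos] at hbefore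
  have hzT : z T = y T := sub_eq_zero.1 hDT
  have hyT := hypos T hT
  have hynonneg : ∀ s, 0 ≤ s → 0 ≤ y s := by
    intro s hs
    rcases hs.eq_or_lt with rfl | h
    · exact hy0.ge
    · exact (hypos s h).le
  have hzpos : ∀ s ∈ Icc 0 T, 0 < z s := by
    rintro s ⟨hs0, hsT⟩
    rcases hsT.eq_or_lt with rfl | h
    · rwa [hzT]
    · exact (hynonneg s hs0).trans_lt (hbefore s hs0 h)
  have hzint : ∀ t ∈ Icc 0 T, IntervalIntegrable (fun s => 1 / z s) volume 0 t := by
    intro t ht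
    refine ContinuousOn.intervalIntegrable_of_Icc ht.1 (continuousOn_const.div
      (hz.mono Icc_subset_Ici_self) fun s hs => (hzpos s ⟨hs.1, hs.2.trans ht.2⟩).ne')
  have hcont : ContinuousAt (fun s => 1 / z s - 1 / y s) T :=
    (continuousAt_const.div (hz.continuousAt (Ici_mem_nhds hT)) (hzT ▸ hyT.ne')).sub
      (continuousAt_const.div (hy.continuousAt (Ici_mem_nhds hT)) hyT.ne')
  have hnear : ∀ᶠ s in nhds T, -(1 / 3 : ℝ) < 1 / z s - 1 / y s :=
    hcont.eventually (lt_mem_nhds (by simp only [hzT]; norm_num))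
  obtain ⟨l, hl, hlT⟩ := exists_Ioc_subset_of_mem_nhds hnear ⟨0, hT⟩
  obtain ⟨r, hr, hrT⟩ := exists_between (max_lt hl hT)
  obtain ⟨hlr, hr0⟩ := max_lt_iff.1 hr
  have hD : ∀ t ∈ Icc 0 T,
      z t - y t = z0 + 2 / 3 * t + ∫ s in (0 : ℝ)..t, (1 / z s - 1 / y s) := by
    intro t ht
    rw [integral_sub (hzint t ht) (hyint t ht.1)]
    linarith [hzeq t ht.1 fun s hs => hzpos s ⟨hs.1, hs.2.trans ht.2⟩, hyeq t ht.1]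
  have hrmem : r ∈ Icc 0 T := ⟨hr0.le, hrT.le⟩
  have hTmem : T ∈ Icc 0 T := ⟨hT.le, le_rfl⟩
  have hint : ∀ t ∈ Icc 0 T,
      IntervalIntegrable (fun s => 1 / z s - 1 / y s) volume 0 t :=
    fun t ht => (hzint t ht).sub (hyint t ht.1)
  have hlower : -(1 / 3) * (T - r) ≤ ∫ s in r..T, (1 / z s - 1 / y s) := by
    have h := integral_mono_on hrT.le (intervalIntegrable_const (c := -(1 / 3 : ℝ)))
      ((hint r hrmem).symm.trans (hint T hTmem))
      fun s hs => (hlT ⟨hlr.trans_le hs.1, hs.2⟩ : -(1 / 3 : ℝ) < 1 / z s - 1 / y s).le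
    rw [intervalIntegral.integral_const, smul_eq_mul] at h
    linarith
  have hsplit := integral_add_adjacent_intervals (hint r hrmem)
    ((hint r hrmem).symm.trans (hint T hTmem))
  linarith [hD r hrmem, hD T hTmem, hbefore r hr0.le hrT]
end

section
/- Let w : [0, ∞) → ℝ be continuous with w(0) = 0 and w(t)/t → 0 as t → ∞. Let y : [0, ∞) → ℝ be continuous with y(0) = 0, y(t) > 0 for all t > 0, y(t) = ∫_{0}^{t} (1/y(s)) ds + w(t) for all t ≥ 0 (the integral being finite), and y(t)/t → 0 as t → ∞. Let z0 > 0 and let z : [0, ∞) → ℝ be continuous with z(0) = z0 and such that for every t ≥ 0 with z(s) > 0 for all s ∈ [0, t] one has z(t) = z0 + (2/3) t + ∫_{0}^{t} (1/z(s)) ds + w(t). Then z(t) > 0 for all t ≥ 0 and z(t)/t → 2/3 as t → ∞. -/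
open Set Filter MeasureTheory intervalIntegral

/-- Comparison with the Bessel path: a solution of `dz = c dt + (1/z)dt + dw` with `c > 0` that
starts above a solution `y` of `dy = (1/y)dt + dw` with `y(0) = 0` stays above it. -/
theorem bessel_lt_of_drift
    {w y z : ℝ → ℝ} {c z0 : ℝ} (hc : 0 < c) (hy : ContinuousOn y (Ici 0)) (hy0 : y 0 = 0)
    (hypos : ∀ t : ℝ, 0 < t → 0 < y t)
    (hyint : ∀ t : ℝ, 0 ≤ t → IntervalIntegrable (fun s => 1 / y s) volume 0 t)
    (hyeq : ∀ t : ℝ, 0 ≤ t → y t = (∫ s in (0 : ℝ)..t, 1 / y s) + w t)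
    (hz0 : 0 < z0) (hz : ContinuousOn z (Ici 0)) (hzinit : z 0 = z0)
    (hzeq : ∀ t : ℝ, 0 ≤ t → (∀ s ∈ Icc (0 : ℝ) t, 0 < z s) →
      z t = z0 + c * t + (∫ s in (0 : ℝ)..t, 1 / z s) + w t)
    {t : ℝ} (ht : 0 ≤ t) : y t < z t := by
  by_contra! hle
  have hu : ContinuousOn (fun s => z s - y s) (Ici 0) := hz.sub hy
  have hroot : ∀ s, 0 ≤ s → z s ≤ y s → ∃ r ∈ Icc 0 s, z r - y r = 0 := by
    intro s hs hzy
    have h0 : (0 : ℝ) ∈ Icc (z s - y s) (z 0 - y 0) := by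
      constructor <;> linarith
    exact intermediate_value_Icc' hs (hu.mono Icc_subset_Ici_self) h0
  obtain ⟨r, hr, hr0⟩ := hroot t ht hle
  have hcl : IsClosed (Ici (0 : ℝ) ∩ (fun s => z s - y s) ⁻¹' {0}) :=
    hu.preimage_isClosed_of_isClosed isClosed_Ici isClosed_singleton
  have hbdd : BddBelow (Ici (0 : ℝ) ∩ (fun s => z s - y s) ⁻¹' {0}) := ⟨0, fun s hs => hs.1⟩
  obtain ⟨τ, ⟨hτ0, hτz⟩, hτmin⟩ :
      ∃ τ, IsLeast (Ici (0 : ℝ) ∩ (fun s => z s - y s) ⁻¹' {0}) τ :=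
    ⟨_, hcl.isLeast_csInf ⟨r, hr.1, hr0⟩ hbdd⟩
  have hzy : z τ = y τ := sub_eq_zero.mp hτz
  have hτpos : 0 < τ := by
    refine lt_of_le_of_ne hτ0 ?_
    rintro rfl
    linarith
  have hbefore : ∀ s, 0 ≤ s → s < τ → y s < z s := by
    intro s hs hsτ
    by_contra! h
    obtain ⟨q, hq, hq0⟩ := hroot s hs h
    have := hτmin ⟨hq.1, hq0⟩
    linarith [hq.2]
  have hznn : ∀ s ∈ Icc 0 τ, 0 < z s := by
    intro s hs
    rcases hs.1.eq_or_lt with rfl | hs0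
    · linarith
    rcases hs.2.eq_or_lt with rfl | hsτ
    · rw [hzy]; exact hypos _ hτpos
    · exact (hypos s hs0).trans (hbefore s hs.1 hsτ)
  have hzint : ∀ s ∈ Icc 0 τ, IntervalIntegrable (fun x => 1 / z x) volume 0 s := by
    intro s hs
    refine ContinuousOn.intervalIntegrable ?_
    rw [uIcc_of_le hs.1]
    exact continuousOn_const.div (hz.mono Icc_subset_Ici_self)
      fun x hx => (hznn x ⟨hx.1, hx.2.trans hs.2⟩).ne'
  have hueq : ∀ s ∈ Icc 0 τ,
      z s - y s = z0 + c * s + ∫ x in (0 : ℝ)..s, (1 / z x - 1 / y x) := by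
    intro s hs
    rw [integral_sub (hzint s hs) (hyint s hs.1),
      hzeq s hs.1 fun x hx => hznn x ⟨hx.1, hx.2.trans hs.2⟩, hyeq s hs.1]
    ring
  have hcont : ContinuousAt (fun x => 1 / z x - 1 / y x) τ := by
    have hyτ := hypos τ hτpos
    have hmem := Ici_mem_nhds hτpos
    exact (continuousAt_const.div (hz.continuousAt hmem) (by rw [hzy]; exact hyτ.ne')).sub
      (continuousAt_const.div (hy.continuousAt hmem) hyτ.ne')
  have hev : ∀ᶠ x in nhds τ, -c < 1 / z x - 1 / y x := by
    apply hcont.eventually_const_lt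
    simp [hzy, hc]
  obtain ⟨a, ⟨ha0, haτ⟩, ha⟩ := exists_Ioc_subset_of_mem_nhds' hev hτpos
  have hbτ : (a + τ) / 2 < τ := by linarith
  have hab : a < (a + τ) / 2 := by linarith
  have hb0 : 0 ≤ (a + τ) / 2 := by linarith
  generalize (a + τ) / 2 = b at hbτ hab hb0
  have hbI : b ∈ Icc 0 τ := ⟨hb0, hbτ.le⟩
  have hτI : τ ∈ Icc 0 τ := ⟨hτpos.le, le_rfl⟩
  have hintb := (hzint b hbI).sub (hyint b hb0)
  have hintτ := (hzint τ hτI).sub (hyint τ hτpos.le)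
  have hbound : ∫ _ in b..τ, -c ≤ ∫ x in b..τ, (1 / z x - 1 / y x) :=
    integral_mono_on hbτ.le intervalIntegrable_const (hintb.symm.trans hintτ)
      fun x hx => le_of_lt (ha ⟨hab.trans_le hx.1, hx.2⟩)
  have hsplit := integral_add_adjacent_intervals hintb (hintb.symm.trans hintτ)
  rw [intervalIntegral.integral_const, smul_eq_mul] at hbound
  have h1 := hueq b hbI
  have h2 := hueq τ hτI
  have h3 := hbefore b hb0 hbτ
  linarith

/-- Pathwise content of Theorem 3.3 (main theorem): if the driving path `w` and the
Bessel path `y` (`dy = (1/y)dt + dw`, `y(0) = 0`, `y > 0` for `t > 0`) grow sublinearly,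
then the pathwise solution `z` of `dz = (2/3)dt + (1/z)dt + dw` with `z(0) = z0 > 0` is
globally positive and satisfies `z(t)/t → 2/3` as `t → ∞`. -/
theorem ito_global_existence_asymptotics
    (w : ℝ → ℝ) (hw : ContinuousOn w (Ici 0)) (hw0 : w 0 = 0)
    (hwsub : Tendsto (fun t => w t / t) atTop (nhds 0))
    (y : ℝ → ℝ) (hy : ContinuousOn y (Ici 0)) (hy0 : y 0 = 0)
    (hypos : ∀ t : ℝ, 0 < t → 0 < y t)
    (hyint : ∀ t : ℝ, 0 ≤ t → IntervalIntegrable (fun s => 1 / y s) volume 0 t)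
    (hyeq : ∀ t : ℝ, 0 ≤ t → y t = (∫ s in (0 : ℝ)..t, 1 / y s) + w t)
    (hysub : Tendsto (fun t => y t / t) atTop (nhds 0))
    (z0 : ℝ) (hz0 : 0 < z0)
    (z : ℝ → ℝ) (hz : ContinuousOn z (Ici 0)) (hzinit : z 0 = z0)
    (hzeq : ∀ t : ℝ, 0 ≤ t → (∀ s ∈ Icc (0 : ℝ) t, 0 < z s) →
      z t = z0 + (2 / 3) * t + (∫ s in (0 : ℝ)..t, 1 / z s) + w t) :
    (∀ t : ℝ, 0 ≤ t → 0 < z t) ∧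
    Tendsto (fun t => z t / t) atTop (nhds (2 / 3)) := by
  have hlt : ∀ t : ℝ, 0 ≤ t → y t < z t := fun t ht =>
    bessel_lt_of_drift (by norm_num) hy hy0 hypos hyint hyeq hz0 hz hzinit hzeq ht
  have hynn : ∀ t : ℝ, 0 ≤ t → 0 ≤ y t := by
    intro t ht
    rcases ht.eq_or_lt with rfl | ht
    · exact hy0.ge
    · exact (hypos t ht).le
  have hzpos : ∀ t : ℝ, 0 ≤ t → 0 < z t := fun t ht => (hynn t ht).trans_lt (hlt t ht)
  refine ⟨hzpos, ?_⟩
  have hz0div : Tendsto (fun t : ℝ => z0 / t + 2 / 3) atTop (nhds (0 + 2 / 3)) :=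
    (tendsto_id.const_div_atTop z0).add_const _
  have hlow := hz0div.add hwsub
  have hupp := hz0div.add hysub
  rw [zero_add, add_zero] at hlow hupp
  refine tendsto_of_tendsto_of_tendsto_of_le_of_le' hlow hupp ?_ ?_
  · filter_upwards [eventually_gt_atTop 0] with t ht
    have hint : 0 ≤ ∫ s in (0 : ℝ)..t, 1 / z s :=
      integral_nonneg ht.le fun s hs => (one_div_pos.mpr (hzpos s hs.1)).le
    have heq := hzeq t ht.le fun s hs => hzpos s hs.1
    have hsum : z0 / t + 2 / 3 + w t / t = (z0 + 2 / 3 * t + w t) / t := by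
      field_simp
    rw [hsum]
    gcongr
    linarith
  · filter_upwards [eventually_gt_atTop 0] with t ht
    have hzint : IntervalIntegrable (fun x => 1 / z x) volume 0 t := by
      refine ContinuousOn.intervalIntegrable ?_
      rw [uIcc_of_le ht.le]
      exact continuousOn_const.div (hz.mono Icc_subset_Ici_self) fun x hx => (hzpos x hx.1).ne'
    have hint : ∫ s in (0 : ℝ)..t, 1 / z s ≤ ∫ s in (0 : ℝ)..t, 1 / y s :=
      integral_mono_on_of_le_Ioo ht.le hzint (hyint t ht.le) fun s hs =>
        one_div_le_one_div_of_le (hypos s hs.1) (hlt s hs.1.le).le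
    have heq := hzeq t ht.le fun s hs => hzpos s hs.1
    have hyt := hyeq t ht.le
    have hsum : z0 / t + 2 / 3 + y t / t = (z0 + 2 / 3 * t + y t) / t := by
      field_simp
    rw [hsum]
    gcongr
    linarith
end

section
/- Let w : [0, ∞) → ℝ be continuous with w(0) = 0. Let y : [0, ∞) → ℝ be continuous with y(0) = 0, y(t) > 0 for all t > 0, and y(t) = ∫_{0}^{t} (1/y(s)) ds + w(t) for all t ≥ 0, the integral being finite. Let H0 > 0 and let z : [0, ∞) → ℝ be continuous with z(0) = 2/(3H0), z(t) > 0 for all t ≥ 0, z(t) ≥ y(t) for all t ≥ 0, and z(t) = 2/(3H0) + (2/3) t + ∫_{0}^{t} (1/z(s)) ds + w(t) for all t ≥ 0. Define H(t) := 1/((3/2) z(t)). Then for all t ≥ 0: 1/((3/2) y(t) + t + 1/H0) ≤ H(t) ≤ 1/ max{ (3/2) w(t) + t + 1/H0 , (3/2) y(t) }. -/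
open Set MeasureTheory intervalIntegral

/-- Explicit pathwise bounds on the Hubble parameter in the Itô model (Conclusions):
`H = 1/((3/2) z)`, where `z` solves pathwise `dz = (2/3)dt + (1/z)dt + dw` with
`z(0) = 2/(3 H0)` and dominates the Bessel path `y` (`dy = (1/y)dt + dw`, `y(0) = 0`),
satisfies `1/((3/2) y + t + 1/H0) ≤ H(t) ≤ 1/max{(3/2) w + t + 1/H0, (3/2) y}`. -/
theorem ito_hubble_bounds
    (w : ℝ → ℝ) (hw : ContinuousOn w (Ici 0)) (hw0 : w 0 = 0)
    (y : ℝ → ℝ) (hy : ContinuousOn y (Ici 0)) (hy0 : y 0 = 0)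
    (hypos : ∀ t : ℝ, 0 < t → 0 < y t)
    (hyint : ∀ t : ℝ, 0 ≤ t → IntervalIntegrable (fun s => 1 / y s) volume 0 t)
    (hyeq : ∀ t : ℝ, 0 ≤ t → y t = (∫ s in (0 : ℝ)..t, 1 / y s) + w t)
    (H0 : ℝ) (hH0 : 0 < H0)
    (z : ℝ → ℝ) (hz : ContinuousOn z (Ici 0)) (hzinit : z 0 = 2 / (3 * H0))
    (hzpos : ∀ t : ℝ, 0 ≤ t → 0 < z t)
    (hzy : ∀ t : ℝ, 0 ≤ t → y t ≤ z t)
    (hzeq : ∀ t : ℝ, 0 ≤ t →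
      z t = 2 / (3 * H0) + (2 / 3) * t + (∫ s in (0 : ℝ)..t, 1 / z s) + w t)
    (H : ℝ → ℝ) (hH : ∀ t, H t = 1 / ((3 / 2) * z t)) :
    ∀ t : ℝ, 0 ≤ t →
      1 / ((3 / 2) * y t + t + 1 / H0) ≤ H t ∧
      H t ≤ 1 / max ((3 / 2) * w t + t + 1 / H0) ((3 / 2) * y t) := by
  intro t ht
  have hzint : IntervalIntegrable (fun s => 1 / z s) volume 0 t := by
    refine ContinuousOn.intervalIntegrable_of_Icc ht ?_
    exact continuousOn_const.div (hz.mono Icc_subset_Ici_self) fun s hs => (hzpos s hs.1).ne'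
  have hle : (∫ s in (0 : ℝ)..t, 1 / z s) ≤ ∫ s in (0 : ℝ)..t, 1 / y s :=
    intervalIntegral.integral_mono_on_of_le_Ioo ht hzint (hyint t ht) fun s hs =>
      one_div_le_one_div_of_le (hypos s hs.1) (hzy s hs.1.le)
  have hnonneg : 0 ≤ ∫ s in (0 : ℝ)..t, 1 / z s :=
    intervalIntegral.integral_nonneg ht fun s hs => (one_div_pos.2 (hzpos s hs.1)).le
  have hinit : (3 / 2) * (2 / (3 * H0)) = 1 / H0 := by field_simp
  have hzt := hzpos t ht
  have hyt := hyeq t ht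
  have hzt' := hzeq t ht
  rw [hH t]
  constructor
  · exact one_div_le_one_div_of_le (by linarith) (by linarith)
  · refine one_div_le_one_div_of_le ?_ (max_le (by linarith) (by linarith [hzy t ht]))
    rcases ht.eq_or_lt with rfl | htpos
    · refine lt_max_of_lt_left ?_
      rw [hw0]
      simpa using hH0
    · exact lt_max_of_lt_right (by linarith [hypos t htpos])
end
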